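/- Let γ₁, γ₂ be nonzero real numbers, Ω ⊂ ℝ³ an open set, and Φ : Ω → ℍ(γ₁, γ₂) a function whose four real components are twice continuously differentiable on Ω. If Φ is hyperholomorphic on Ω, then Φ satisfies the second-order equation γ₁ ∂²Φ/∂x² + γ₂ ∂²Φ/∂y² − γ₁γ₂ ∂²Φ/∂z² = 0 at every point of Ω. In particular, for γ₁ = γ₂ = −1 every twice continuously differentiable hyperholomorphic function on Ω ⊂ ℝ³ with values in the real quaternions has harmonic components. -/

import Mathlib

open Quaternion

/-- The 1-variable slice3 of `f : ℝ³ → ℝ` through `p` in coordinate direction `j`. -/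
def slice3 (j : Fin 3) (f : ℝ × ℝ × ℝ → ℝ) (p : ℝ × ℝ × ℝ) : ℝ → ℝ :=
  fun s =>
    if j = 0 then f (s, p.2.1, p.2.2)
    else if j = 1 then f (p.1, s, p.2.2)
    else f (p.1, p.2.1, s)

/-- The `j`-th coordinate of a point of `ℝ³`. -/
def coordP (j : Fin 3) (p : ℝ × ℝ × ℝ) : ℝ :=
  if j = 0 then p.1 else if j = 1 then p.2.1 else p.2.2

/-- The `j`-th first partial derivative of `f : ℝ³ → ℝ` at `p`. -/
noncomputable def pdiff (j : Fin 3) (f : ℝ × ℝ × ℝ → ℝ) (p : ℝ × ℝ × ℝ) : ℝ :=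
  deriv (slice3 j f p) (coordP j p)

/-- `f` has a `j`-th first partial derivative at `p`. -/
def HasPD (j : Fin 3) (f : ℝ × ℝ × ℝ → ℝ) (p : ℝ × ℝ × ℝ) : Prop :=
  DifferentiableAt ℝ (slice3 j f p) (coordP j p)

/-- The element of `ℍ(a,b)` with components `c 0, c 1, c 2, c 3` in the basis `1,e₁,e₂,e₃`. -/
def mkQ (a b : ℝ) (c : Fin 4 → ℝ) : ℍ[ℝ, a, b] := ⟨c 0, c 1, c 2, c 3⟩

/-- The Dirac operator `e₁ ∂/∂x + e₂ ∂/∂y + e₃ ∂/∂z` applied (componentwise) to the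
function `Φ = u₀·1 + u₁ e₁ + u₂ e₂ + u₃ e₃` at `p`. -/
noncomputable def diracQ (a b : ℝ) (u : Fin 4 → ℝ × ℝ × ℝ → ℝ) (p : ℝ × ℝ × ℝ) :
    ℍ[ℝ, a, b] :=
  (⟨0, 1, 0, 0⟩ : ℍ[ℝ, a, b]) * mkQ a b (fun m => pdiff 0 (u m) p) +
    (⟨0, 0, 1, 0⟩ : ℍ[ℝ, a, b]) * mkQ a b (fun m => pdiff 1 (u m) p) +
    (⟨0, 0, 0, 1⟩ : ℍ[ℝ, a, b]) * mkQ a b (fun m => pdiff 2 (u m) p)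

/-- `Φ = u₀·1 + u₁ e₁ + u₂ e₂ + u₃ e₃` is hyperholomorphic on `Ω`:
`e₁ ∂Φ/∂x + e₂ ∂Φ/∂y + e₃ ∂Φ/∂z = 0` on `Ω`. -/
def IsHyperholo (a b : ℝ) (u : Fin 4 → ℝ × ℝ × ℝ → ℝ) (Ω : Set (ℝ × ℝ × ℝ)) : Prop :=
  ∀ p ∈ Ω, diracQ a b u p = 0

/-- The standard basis vectors of `ℝ³`. -/
def basisV (j : Fin 3) : ℝ × ℝ × ℝ :=
  if j = 0 then (1, 0, 0) else if j = 1 then (0, 1, 0) else (0, 0, 1)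

theorem pdiff_eq_fderiv (j : Fin 3) (f : ℝ × ℝ × ℝ → ℝ) (p : ℝ × ℝ × ℝ)
    (hf : DifferentiableAt ℝ f p) : pdiff j f p = fderiv ℝ f p (basisV j) := by
  obtain ⟨x, y, z⟩ := p
  have hF := hf.hasFDerivAt
  unfold pdiff
  apply HasDerivAt.deriv
  fin_cases j
  · have hc : HasDerivAt (fun s : ℝ => (s, y, z)) ((1 : ℝ), (0 : ℝ), (0 : ℝ)) x :=
      (hasDerivAt_id x).prodMk ((hasDerivAt_const x y).prodMk (hasDerivAt_const x z))
    exact hF.comp_hasDerivAt x hc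
  · have hc : HasDerivAt (fun s : ℝ => (x, s, z)) ((0 : ℝ), (1 : ℝ), (0 : ℝ)) y :=
      (hasDerivAt_const y x).prodMk ((hasDerivAt_id y).prodMk (hasDerivAt_const y z))
    exact hF.comp_hasDerivAt y hc
  · have hc : HasDerivAt (fun s : ℝ => (x, y, s)) ((0 : ℝ), (0 : ℝ), (1 : ℝ)) z :=
      (hasDerivAt_const z x).prodMk ((hasDerivAt_const z y).prodMk (hasDerivAt_id z))
    exact hF.comp_hasDerivAt z hc

theorem pdiff_hasFDerivAt (k : Fin 3) (f : ℝ × ℝ × ℝ → ℝ) (Ω : Set (ℝ × ℝ × ℝ))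
    (hΩ : IsOpen Ω) (hf : ContDiffOn ℝ 2 f Ω) (p : ℝ × ℝ × ℝ) (hp : p ∈ Ω) :
    HasFDerivAt (pdiff k f) ((fderiv ℝ (fderiv ℝ f) p).flip (basisV k)) p := by
  have hat : ContDiffAt ℝ 2 f p := hf.contDiffAt (hΩ.mem_nhds hp)
  have hd : DifferentiableAt ℝ (fderiv ℝ f) p :=
    (hat.fderiv_right (m := 1) (by norm_num)).differentiableAt (by norm_num)
  have h1 : HasFDerivAt (fun q => fderiv ℝ f q (basisV k))
      ((fderiv ℝ (fderiv ℝ f) p).flip (basisV k)) p := by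
    have := hd.hasFDerivAt.clm_apply (hasFDerivAt_const (basisV k) p)
    simpa using this
  refine h1.congr_of_eventuallyEq ?_
  filter_upwards [hΩ.mem_nhds hp] with q hq
  exact pdiff_eq_fderiv k f q
    ((hf.contDiffAt (hΩ.mem_nhds hq)).differentiableAt (by norm_num))

theorem pdiff_comm (j k : Fin 3) (f : ℝ × ℝ × ℝ → ℝ) (Ω : Set (ℝ × ℝ × ℝ))
    (hΩ : IsOpen Ω) (hf : ContDiffOn ℝ 2 f Ω) (p : ℝ × ℝ × ℝ) (hp : p ∈ Ω) :
    pdiff j (pdiff k f) p = pdiff k (pdiff j f) p := by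
  have hk := pdiff_hasFDerivAt k f Ω hΩ hf p hp
  have hj := pdiff_hasFDerivAt j f Ω hΩ hf p hp
  rw [pdiff_eq_fderiv j _ p hk.differentiableAt, pdiff_eq_fderiv k _ p hj.differentiableAt,
    hk.fderiv, hj.fderiv]
  have hat : ContDiffAt ℝ 2 f p := hf.contDiffAt (hΩ.mem_nhds hp)
  have := hat.isSymmSndFDerivAt (by simp)
  exact this.eq (basisV j) (basisV k)

theorem pdiff_lin (k : Fin 3) (f g h : ℝ × ℝ × ℝ → ℝ) (Ω : Set (ℝ × ℝ × ℝ))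
    (hΩ : IsOpen Ω) (hf : ContDiffOn ℝ 2 f Ω) (hg : ContDiffOn ℝ 2 g Ω)
    (hh : ContDiffOn ℝ 2 h Ω) (α β δ : ℝ)
    (heq : ∀ q ∈ Ω, α * pdiff 0 f q + β * pdiff 1 g q + δ * pdiff 2 h q = 0)
    (p : ℝ × ℝ × ℝ) (hp : p ∈ Ω) :
    α * pdiff k (pdiff 0 f) p + β * pdiff k (pdiff 1 g) p + δ * pdiff k (pdiff 2 h) p = 0 := by
  have a := pdiff_hasFDerivAt 0 f Ω hΩ hf p hp
  have b := pdiff_hasFDerivAt 1 g Ω hΩ hg p hp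
  have c := pdiff_hasFDerivAt 2 h Ω hΩ hh p hp
  have hs := ((a.const_mul α).add (b.const_mul β)).add (c.const_mul δ)
  have h0 : HasFDerivAt (fun _ : ℝ × ℝ × ℝ => (0 : ℝ)) (0 : ℝ × ℝ × ℝ →L[ℝ] ℝ) p :=
    hasFDerivAt_const 0 p
  have hs' := h0.congr_of_eventuallyEq
    (Filter.eventuallyEq_of_mem (hΩ.mem_nhds hp) (fun q hq => heq q hq))
  have hu := congrArg (fun T : ℝ × ℝ × ℝ →L[ℝ] ℝ => T (basisV k)) (hs.unique hs')
  rw [pdiff_eq_fderiv k _ p a.differentiableAt, pdiff_eq_fderiv k _ p b.differentiableAt,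
    pdiff_eq_fderiv k _ p c.differentiableAt, a.fderiv, b.fderiv, c.fderiv]
  simpa using hu

/-- If `Φ = u₀·1 + u₁e₁ + u₂e₂ + u₃e₃ : Ω → ℍ(γ₁,γ₂)` has twice
continuously differentiable components on the open set `Ω ⊂ ℝ³` and is hyperholomorphic
on `Ω`, then `γ₁ ∂²Φ/∂x² + γ₂ ∂²Φ/∂y² − γ₁γ₂ ∂²Φ/∂z² = 0` on `Ω`; in particular, for
`γ₁ = γ₂ = −1` the components of `Φ` are harmonic. -/
theorem hyperholo_second_order (γ₁ γ₂ : ℝ) (h₁ : γ₁ ≠ 0) (h₂ : γ₂ ≠ 0)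
    (Ω : Set (ℝ × ℝ × ℝ)) (hΩ : IsOpen Ω)
    (u : Fin 4 → ℝ × ℝ × ℝ → ℝ)
    (hC2 : ∀ m, ContDiffOn ℝ 2 (u m) Ω)
    (hholo : IsHyperholo γ₁ γ₂ u Ω) :
    (∀ p ∈ Ω,
      γ₁ • mkQ γ₁ γ₂ (fun m => pdiff 0 (pdiff 0 (u m)) p) +
        γ₂ • mkQ γ₁ γ₂ (fun m => pdiff 1 (pdiff 1 (u m)) p) -
        (γ₁ * γ₂) • mkQ γ₁ γ₂ (fun m => pdiff 2 (pdiff 2 (u m)) p) = 0) ∧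
    (γ₁ = -1 → γ₂ = -1 → ∀ p ∈ Ω, ∀ m : Fin 4,
      pdiff 0 (pdiff 0 (u m)) p + pdiff 1 (pdiff 1 (u m)) p +
        pdiff 2 (pdiff 2 (u m)) p = 0) := by
  have E : ∀ q ∈ Ω,
      (γ₁ * pdiff 0 (u 1) q + γ₂ * pdiff 1 (u 2) q + (-(γ₁ * γ₂)) * pdiff 2 (u 3) q = 0) ∧
      (1 * pdiff 0 (u 0) q + (-γ₂) * pdiff 1 (u 3) q + γ₂ * pdiff 2 (u 2) q = 0) ∧
      (γ₁ * pdiff 0 (u 3) q + 1 * pdiff 1 (u 0) q + (-γ₁) * pdiff 2 (u 1) q = 0) ∧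
      (1 * pdiff 0 (u 2) q + (-1) * pdiff 1 (u 1) q + 1 * pdiff 2 (u 0) q = 0) := by
    intro q hq
    have h := hholo q hq
    unfold diracQ mkQ at h
    have e0 := congrArg QuaternionAlgebra.re h
    have e1 := congrArg QuaternionAlgebra.imI h
    have e2 := congrArg QuaternionAlgebra.imJ h
    have e3 := congrArg QuaternionAlgebra.imK h
    simp at e0 e1 e2 e3
    refine ⟨?_, ?_, ?_, ?_⟩
    · linear_combination e0
    · linear_combination e1
    · linear_combination e2
    · linear_combination e3
  have key : ∀ p ∈ Ω, ∀ m : Fin 4, γ₁ * pdiff 0 (pdiff 0 (u m)) p +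
      γ₂ * pdiff 1 (pdiff 1 (u m)) p - (γ₁ * γ₂) * pdiff 2 (pdiff 2 (u m)) p = 0 := by
    intro p hp m
    have F0 := fun k => pdiff_lin k _ _ _ Ω hΩ (hC2 1) (hC2 2) (hC2 3) _ _ _
      (fun q hq => (E q hq).1) p hp
    have F1 := fun k => pdiff_lin k _ _ _ Ω hΩ (hC2 0) (hC2 3) (hC2 2) _ _ _
      (fun q hq => (E q hq).2.1) p hp
    have F2 := fun k => pdiff_lin k _ _ _ Ω hΩ (hC2 3) (hC2 0) (hC2 1) _ _ _
      (fun q hq => (E q hq).2.2.1) p hp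
    have F3 := fun k => pdiff_lin k _ _ _ Ω hΩ (hC2 2) (hC2 1) (hC2 0) _ _ _
      (fun q hq => (E q hq).2.2.2) p hp
    have c01 := fun m => pdiff_comm 1 0 (u m) Ω hΩ (hC2 m) p hp
    have c02 := fun m => pdiff_comm 2 0 (u m) Ω hΩ (hC2 m) p hp
    have c12 := fun m => pdiff_comm 2 1 (u m) Ω hΩ (hC2 m) p hp
    have F00 := F0 0
    have F01 := F0 1
    have F02 := F0 2
    have F10 := F1 0
    have F11 := F1 1
    have F12 := F1 2
    have F20 := F2 0
    have F21 := F2 1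
    have F22 := F2 2
    have F30 := F3 0
    have F31 := F3 1
    have F32 := F3 2
    simp only [c01, c02, c12] at F00 F01 F02 F10 F11 F12 F20 F21 F22 F30 F31 F32
    fin_cases m
    · show γ₁ * pdiff 0 (pdiff 0 (u 0)) p + γ₂ * pdiff 1 (pdiff 1 (u 0)) p -
        (γ₁ * γ₂) * pdiff 2 (pdiff 2 (u 0)) p = 0
      linear_combination γ₁ * F10 + γ₂ * F21 - γ₁ * γ₂ * F32
    · show γ₁ * pdiff 0 (pdiff 0 (u 1)) p + γ₂ * pdiff 1 (pdiff 1 (u 1)) p -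
        (γ₁ * γ₂) * pdiff 2 (pdiff 2 (u 1)) p = 0
      linear_combination F00 - γ₂ * F31 + γ₂ * F22
    · show γ₁ * pdiff 0 (pdiff 0 (u 2)) p + γ₂ * pdiff 1 (pdiff 1 (u 2)) p -
        (γ₁ * γ₂) * pdiff 2 (pdiff 2 (u 2)) p = 0
      linear_combination γ₁ * F30 + F01 - γ₁ * F12
    · show γ₁ * pdiff 0 (pdiff 0 (u 3)) p + γ₂ * pdiff 1 (pdiff 1 (u 3)) p -
        (γ₁ * γ₂) * pdiff 2 (pdiff 2 (u 3)) p = 0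
      linear_combination F20 - F11 + F02
  refine ⟨?_, ?_⟩
  · intro p hp
    have k := key p hp
    unfold mkQ
    ext
    · simpa using k 0
    · simpa using k 1
    · simpa using k 2
    · simpa using k 3
  · intro g1 g2 p hp m
    have k := key p hp m
    rw [g1, g2] at k
    linear_combination -k
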